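/- arXiv:2109.14140 — 2 statements merged into one kernel-verified Lean document; each statement's English description precedes it below -/
import Mathlib

section
/- Let g ≡ 0 (mod 3), g,n ≥ 3, a ≥ 1, λ ∈ {2,4}, and v = 2agn + 2, and suppose there exists a g-PCS_2((2ag)^n : 2). Suppose further that there exists a simple S_6(2,3,2ag+2) and an NWBTS(2ag+2;c) where (2ag+2,c) satisfies condition (C1) with associated pair (λ,ε). Then for every integer q with 0 ≤ q ≤ n−1, there exists an NWBTS(v;b) with b = q·v(v−1) + b′, where b′ is the integer with 3b′ = λ·binom(v,2) + ε. -/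
namespace DataPlacement

open Finset

variable {α : Type*} [DecidableEq α]

/-- Number of blocks of the family `F` (with multiplicity) containing `T`. -/
def lamF (F : Multiset (Finset α)) (T : Finset α) : ℕ :=
  Multiset.card (F.filter fun B => T ⊆ B)

/-- Triple system with `b` blocks on a point set `X` of size `v`. -/
def IsTSOn (X : Finset α) (v b : ℕ) (F : Multiset (Finset α)) : Prop :=
  X.card = v ∧ Multiset.card F = b ∧ ∀ B ∈ F, B.card = 3 ∧ B ⊆ X

/-- `(l, e)` is the pair associated with `(v, b)`:
`3b = l·v(v−1)/2 + e` with `−v/2 < e < v/2`. -/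
def AssocPair (v b l : ℕ) (e : ℤ) : Prop :=
  6 * (b : ℤ) = (l : ℤ) * v * ((v : ℤ) - 1) + 2 * e ∧
    -(v : ℤ) < 2 * e ∧ 2 * e < (v : ℤ)

/-- Condition (C1). -/
def CondC1 (v b : ℕ) : Prop :=
  v % 3 = 2 ∧ ∃ l : ℕ, 0 < l ∧
    ((v % 6 = 5 ∧ (l % 3 = 1 ∨ l % 3 = 2)) ∨
     (v % 6 = 2 ∧ (l % 6 = 2 ∨ l % 6 = 4))) ∧
    (b = l * v * (v - 1) / 6 ∨ b = (l * v * (v - 1) + 5) / 6)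

/-- Condition (C2). -/
def CondC2 (v b : ℕ) : Prop :=
  v % 2 = 0 ∧ ∃ l : ℕ, 0 < l ∧ l % 2 = 1 ∧
    (l : ℤ) * v * ((v : ℤ) - 1) - v < 6 * (b : ℤ) ∧
    6 * (b : ℤ) < (l : ℤ) * v * ((v : ℤ) - 1) + v

/-- Pairs of points of `X` whose block count equals `l + i`. -/
def Dlev (X : Finset α) (F : Multiset (Finset α)) (l : ℕ) (i : ℤ) :
    Finset (Finset α) :=
  (X.powersetCard 2).filter fun p => (lamF F p : ℤ) = (l : ℤ) + i

/-- Every pair of points of `X` lies in `l−1`, `l`, or `l+1` blocks. -/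
def PairRangeOn (X : Finset α) (F : Multiset (Finset α)) (l : ℕ) : Prop :=
  ∀ p ∈ X.powersetCard 2,
    (l : ℤ) - 1 ≤ (lamF F p : ℤ) ∧ (lamF F p : ℤ) ≤ (l : ℤ) + 1

def IsTriangle (D : Finset (Finset α)) : Prop :=
  ∃ x y z : α, x ≠ y ∧ x ≠ z ∧ y ≠ z ∧
    D = {({x, y} : Finset α), {y, z}, {x, z}}

def IsFourCycle (D : Finset (Finset α)) : Prop :=
  ∃ x y z w : α, x ≠ y ∧ x ≠ z ∧ x ≠ w ∧ y ≠ z ∧ y ≠ w ∧ z ≠ w ∧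
    D = {({x, y} : Finset α), {y, z}, {z, w}, {x, w}}

/-- `D` is a perfect matching on the point set `X`. -/
def IsPerfectMatchingOn (X : Finset α) (D : Finset (Finset α)) : Prop :=
  (∀ p ∈ D, p.card = 2 ∧ p ⊆ X) ∧ ∀ x ∈ X, ∃! p, p ∈ D ∧ x ∈ p

/-- Defect-graph shape required for nearly 2-balance under (C1). -/
def C1ShapeOn (X : Finset α) (F : Multiset (Finset α)) (l : ℕ) (e : ℤ) : Prop :=
  (e = 1 ∧ IsTriangle (Dlev X F l 1 ∪ Dlev X F l (-1)) ∧
     (Dlev X F l 1).card = 2 ∧ (Dlev X F l (-1)).card = 1) ∨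
  (e = -1 ∧ IsTriangle (Dlev X F l 1 ∪ Dlev X F l (-1)) ∧
     (Dlev X F l 1).card = 1 ∧ (Dlev X F l (-1)).card = 2) ∨
  (e = 2 ∧ IsFourCycle (Dlev X F l 1 ∪ Dlev X F l (-1)) ∧
     (Dlev X F l 1).card = 3 ∧ (Dlev X F l (-1)).card = 1) ∨
  (e = -2 ∧ IsFourCycle (Dlev X F l 1 ∪ Dlev X F l (-1)) ∧
     (Dlev X F l 1).card = 1 ∧ (Dlev X F l (-1)).card = 3)

/-- Defect-graph shape required for nearly 2-balance under (C2)
(here `v = X.card`). -/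
def C2ShapeOn (X : Finset α) (v : ℕ) (F : Multiset (Finset α)) (l : ℕ) (e : ℤ) : Prop :=
  (((v : ℤ) - 2 * e) % 4 = 0 ∧
    IsPerfectMatchingOn X (Dlev X F l 1 ∪ Dlev X F l (-1)) ∧
    4 * ((Dlev X F l 1).card : ℤ) = (v : ℤ) + 2 * e ∧
    4 * ((Dlev X F l (-1)).card : ℤ) = (v : ℤ) - 2 * e) ∨
  (((v : ℤ) - 2 * e) % 4 ≠ 0 ∧
    ∃ (c a₂ a₃ a₄ : α) (star : Finset (Finset α)),
      c ∈ X ∧ a₂ ∈ X ∧ a₃ ∈ X ∧ a₄ ∈ X ∧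
      c ≠ a₂ ∧ c ≠ a₃ ∧ c ≠ a₄ ∧ a₂ ≠ a₃ ∧ a₂ ≠ a₄ ∧ a₃ ≠ a₄ ∧
      star = {({c, a₂} : Finset α), {c, a₃}, {c, a₄}} ∧
      star ⊆ Dlev X F l 1 ∪ Dlev X F l (-1) ∧
      IsPerfectMatchingOn (X \ {c, a₂, a₃, a₄})
        ((Dlev X F l 1 ∪ Dlev X F l (-1)) \ star) ∧
      (((star ∩ Dlev X F l 1).card = 2 ∧ (star ∩ Dlev X F l (-1)).card = 1 ∧
          4 * (((Dlev X F l 1) \ star).card : ℤ) = (v : ℤ) - 6 + 2 * e ∧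
          4 * (((Dlev X F l (-1)) \ star).card : ℤ) = (v : ℤ) - 2 - 2 * e) ∨
        ((star ∩ Dlev X F l 1).card = 1 ∧ (star ∩ Dlev X F l (-1)).card = 2 ∧
          4 * (((Dlev X F l 1) \ star).card : ℤ) = (v : ℤ) - 2 + 2 * e ∧
          4 * (((Dlev X F l (-1)) \ star).card : ℤ) = (v : ℤ) - 6 - 2 * e)))

/-- `F` is 3-balanced on `X`: the multiplicities of any two triples of `X`
differ by at most one. -/
def ThreeBalancedOn (X : Finset α) (F : Multiset (Finset α)) : Prop :=
  ∀ T₁ ∈ X.powersetCard 3, ∀ T₂ ∈ X.powersetCard 3, F.count T₁ ≤ F.count T₂ + 1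

/-- Nearly well-balanced triple system NWBTS(v;b) on the point set `X`. -/
def IsNWBTSOn (X : Finset α) (v b : ℕ) (F : Multiset (Finset α)) : Prop :=
  IsTSOn X v b F ∧ ThreeBalancedOn X F ∧
  ∃ (l : ℕ) (e : ℤ), 0 < l ∧ AssocPair v b l e ∧ PairRangeOn X F l ∧
    ((CondC1 v b ∧ C1ShapeOn X F l e) ∨ (CondC2 v b ∧ C2ShapeOn X v F l e))

/-- `B` is an S_mu(2,3,·) design on the point set `X`. -/
def IsSDesignOn (X : Finset α) (mu : ℕ) (B : Multiset (Finset α)) : Prop :=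
  (∀ A ∈ B, A.card = 3 ∧ A ⊆ X) ∧ ∀ p ∈ X.powersetCard 2, lamF B p = mu

/-- `B` is a GDD_mu(2,3,·) of type `1^{·}u^1` on `X` with long group `U`. -/
def IsGDD1u (X : Finset α) (mu u : ℕ) (U : Finset α) (B : Multiset (Finset α)) : Prop :=
  U ⊆ X ∧ U.card = u ∧
  (∀ A ∈ B, A.card = 3 ∧ A ⊆ X ∧ (A ∩ U).card ≤ 1) ∧
  ∀ p ∈ X.powersetCard 2, ¬ p ⊆ U → lamF B p = mu

/-- `B` is a GDD_mu(2,3,·) with group family `G`. -/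
def IsGDDgroups (mu : ℕ) {n : ℕ} (G : Fin n → Finset α) (B : Multiset (Finset α)) : Prop :=
  (∀ A ∈ B, A.card = 3 ∧ A ⊆ Finset.univ.biUnion G ∧ ∀ i, (A ∩ G i).card ≤ 1) ∧
  ∀ x y : α, x ≠ y → (∃ i j, i ≠ j ∧ x ∈ G i ∧ y ∈ G j) → lamF B {x, y} = mu

/-- Nearly group divisible design NGDD(2,3,·) of type `2^{(m,n)}u^1` on `X`. -/
def IsNGDD (X : Finset α) (m n u : ℕ) (G : Fin (m + n) → Finset α) (U : Finset α)
    (B : Multiset (Finset α)) : Prop :=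
  (∀ i, (G i).card = 2 ∧ G i ⊆ X) ∧ U.card = u ∧ U ⊆ X ∧
  (∀ i j, i ≠ j → Disjoint (G i) (G j)) ∧ (∀ i, Disjoint (G i) U) ∧
  U ∪ Finset.univ.biUnion G = X ∧
  (∀ A ∈ B, A.card = 3 ∧ A ⊆ X) ∧
  (∀ i : Fin (m + n), (i : ℕ) < m → lamF B (G i) = 2) ∧
  (∀ i : Fin (m + n), m ≤ (i : ℕ) → lamF B (G i) = 0) ∧
  (∀ p ∈ U.powersetCard 2, lamF B p = 0) ∧
  (∀ p ∈ X.powersetCard 2, (∀ i, ¬ p ⊆ G i) → ¬ p ⊆ U → lamF B p = 1)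

/-- Candelabra system CS(g^n : s) on `X` with stem `S` and groups `G`. -/
def IsCS (X : Finset α) (g n s : ℕ) (S : Finset α) (G : Fin n → Finset α)
    (A : Multiset (Finset α)) : Prop :=
  S.card = s ∧ S ⊆ X ∧ (∀ i, (G i).card = g ∧ G i ⊆ X) ∧
  (∀ i j, i ≠ j → Disjoint (G i) (G j)) ∧ (∀ i, Disjoint (G i) S) ∧
  S ∪ Finset.univ.biUnion G = X ∧
  (∀ B ∈ A, B.card = 3 ∧ B ⊆ X) ∧
  (∀ T ∈ X.powersetCard 3, (∀ i, ¬ T ⊆ S ∪ G i) → lamF A T = 1) ∧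
  (∀ T ∈ X.powersetCard 3, (∃ i, T ⊆ S ∪ G i) → lamF A T = 0)

/-- Partitionable candelabra system PCS(g^n : s). -/
def IsPCS (X : Finset α) (g n s : ℕ) (S : Finset α) (G : Fin n → Finset α)
    (A : Multiset (Finset α)) : Prop :=
  IsCS X g n s S G A ∧
  ∃ (Ax : α → Multiset (Finset α)) (Ai : Fin (s - 2) → Multiset (Finset α)),
    A = (∑ p ∈ X \ S, Ax p) + ∑ i, Ai i ∧
    (∀ i : Fin n, ∀ p ∈ G i, IsGDD1u X 1 (g + s) (G i ∪ S) (Ax p)) ∧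
    (∀ j, IsGDDgroups 1 G (Ai j))

/-- g-PCS_2((2ag)^n : s). -/
def IsGPCS2 (X : Finset α) (a g n s : ℕ) (S : Finset α) (G : Fin n → Finset α)
    (A : Multiset (Finset α)) : Prop :=
  IsCS X (2 * a * g) n s S G A ∧
  ∃ (P : Fin (g * n) → Multiset (Finset α)) (grp : Fin (g * n) → Fin n),
    (∑ i, P i) ≤ A ∧
    (∀ j : Fin n, (Finset.univ.filter fun i => grp i = j).card = g) ∧
    (∀ i, IsGDD1u X 2 (2 * a * g + s) (G (grp i) ∪ S) (P i))

/-- g-PCS_2^r((2ag)^n : s). -/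
def IsGPCS2r (X : Finset α) (a g n s r : ℕ) (S : Finset α) (G : Fin n → Finset α)
    (A : Multiset (Finset α)) : Prop :=
  IsCS X (2 * a * g) n s S G A ∧
  ∃ (P : Fin (g * n) → Multiset (Finset α)) (grp : Fin (g * n) → Fin n),
    (∑ i, P i) ≤ A ∧
    (∀ j : Fin n, (Finset.univ.filter fun i => grp i = j).card = g) ∧
    (∀ i, IsGDD1u X 2 (2 * a * g + s) (G (grp i) ∪ S) (P i)) ∧
    ∃ (i : Fin (g * n)) (N : Multiset (Finset α))
      (Gs : Fin (r + (a * g * (n - 1) - r)) → Finset α),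
      N ≤ P i ∧ IsNGDD X r (a * g * (n - 1) - r) (2 * a * g + s) Gs (G (grp i) ∪ S) N

/-- GDD(3,3,·) of type `g^k` on `X` with groups `H`. -/
def IsGDD3On (X : Finset α) (g : ℕ) {k : ℕ} (H : Fin k → Finset α)
    (A : Multiset (Finset α)) : Prop :=
  (∀ i, (H i).card = g ∧ H i ⊆ X) ∧ (∀ i j, i ≠ j → Disjoint (H i) (H j)) ∧
  Finset.univ.biUnion H = X ∧
  (∀ B ∈ A, B.card = 3 ∧ B ⊆ X ∧ ∀ i, (B ∩ H i).card ≤ 1) ∧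
  (∀ T ∈ X.powersetCard 3, (∀ i, (T ∩ H i).card ≤ 1) → lamF A T = 1)

/-- `B` is a GDD_mu(2,3,·) on the points not in the omitted group `H o`,
with group set `{H i : i ≠ o}`. -/
def IsGDDOmit (mu : ℕ) {k : ℕ} (H : Fin k → Finset α) (o : Fin k)
    (B : Multiset (Finset α)) : Prop :=
  (∀ A ∈ B, A.card = 3 ∧ Disjoint A (H o) ∧ ∀ i, (A ∩ H i).card ≤ 1) ∧
  ∀ x y : α, x ≠ y →
    (∃ i j, i ≠ j ∧ i ≠ o ∧ j ≠ o ∧ x ∈ H i ∧ y ∈ H j) → lamF B {x, y} = mu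

/-- PGDD_2((2g)^{n+1}). -/
def IsPGDD2 (g n : ℕ) (H : Fin (n + 1) → Finset (Fin (2 * g * (n + 1))))
    (A : Multiset (Finset (Fin (2 * g * (n + 1))))) : Prop :=
  IsGDD3On Finset.univ (2 * g) H A ∧
  ∃ (i0 : Fin (n + 1))
    (P : Fin (g * n + 2 * g) → Multiset (Finset (Fin (2 * g * (n + 1)))))
    (f : Fin (g * n + 2 * g) → Fin (n + 1)),
    A = ∑ i, P i ∧
    (∀ j, j ≠ i0 → (Finset.univ.filter fun i => f i = j).card = g) ∧
    (∀ i, f i ≠ i0 → IsGDDOmit 2 H (f i) (P i)) ∧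
    (∀ i, f i = i0 → IsGDDOmit 1 H i0 (P i))

/-- 1-FG(3,(K1,KT),n) of type 1^n. -/
def Is1FG (n : ℕ) (K1 KT : Set ℕ) (A1 AT : Multiset (Finset (Fin n))) : Prop :=
  (∀ B ∈ A1, B.card ∈ K1) ∧ (∀ B ∈ AT, B.card ∈ KT) ∧
  (∀ p ∈ (Finset.univ : Finset (Fin n)).powersetCard 2, lamF A1 p = 1) ∧
  (∀ T ∈ (Finset.univ : Finset (Fin n)).powersetCard 3, lamF (A1 + AT) T = 1)

/-- PICS_2^r((2g)^3 : 0). -/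
def IsPICS2 (g r : ℕ) (G : Fin 3 → Finset (Fin (6 * g)))
    (A : Multiset (Finset (Fin (6 * g)))) : Prop :=
  IsCS Finset.univ (2 * g) 3 0 (∅ : Finset (Fin (6 * g))) G A ∧
  ∃ P : Fin (4 * g - 2) → Multiset (Finset (Fin (6 * g))),
    A = ∑ i, P i ∧
    (∀ i : Fin (4 * g - 2), (i : ℕ) < 2 * g → IsSDesignOn Finset.univ 2 (P i)) ∧
    (∃ i : Fin (4 * g - 2), (i : ℕ) < 2 * g ∧
      ∃ (N : Multiset (Finset (Fin (6 * g))))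
        (Gs : Fin (r + (3 * g - r)) → Finset (Fin (6 * g))),
        N ≤ P i ∧ IsNGDD Finset.univ r (3 * g - r) 0 Gs ∅ N) ∧
    (∀ i : Fin (4 * g - 2), 2 * g ≤ (i : ℕ) → IsGDDgroups 1 G (P i))

/-- Number of ordered pairs of blocks of `F` whose intersection has exactly
`j` points. -/
def interCount (F : Multiset (Finset α)) (j : ℕ) : ℕ :=
  Multiset.card
    ((F.bind fun A => F.map fun B => (A, B)).filter fun p => (p.1 ∩ p.2).card = j)

/-- The polynomial `P(F, x) = Σ_{j=0}^{3} v_j x^j`. -/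
noncomputable def Pval (F : Multiset (Finset α)) (x : ℝ) : ℝ :=
  ∑ j ∈ Finset.range 4, (interCount F j : ℝ) * x ^ j

/-- Optimal data placement for triple replication. -/
def IsOptimalDP (v b : ℕ) (F : Multiset (Finset (Fin v))) : Prop :=
  IsTSOn Finset.univ v b F ∧
  ∀ F' : Multiset (Finset (Fin v)), IsTSOn Finset.univ v b F' →
    ∀ x : ℝ, 1 ≤ x → Pval F x ≤ Pval F' x


theorem lamF_add' (F F' : Multiset (Finset α)) (T : Finset α) :
    lamF (F + F') T = lamF F T + lamF F' T := by
  simp [lamF]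

theorem lamF_sum' {ι : Type*} (s : Finset ι) (F : ι → Multiset (Finset α)) (T : Finset α) :
    lamF (∑ i ∈ s, F i) T = ∑ i ∈ s, lamF (F i) T := by
  classical
  induction s using Finset.induction_on with
  | empty => simp [lamF]
  | insert a s ha ih => rw [Finset.sum_insert ha, Finset.sum_insert ha, lamF_add', ih]

theorem lamF_map' {β : Type*} [DecidableEq β] (f : β ↪ α) (F : Multiset (Finset β))
    (T : Finset β) : lamF (F.map (Finset.map f)) (T.map f) = lamF F T := by
  simp [lamF, Multiset.filter_map, Finset.map_subset_map]

theorem lamF_zero_of (F : Multiset (Finset α)) (T : Finset α) (h : ∀ B ∈ F, ¬ T ⊆ B) :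
    lamF F T = 0 := by
  rw [lamF, Multiset.card_eq_zero, Multiset.filter_eq_nil]
  exact h

theorem double_count (X : Finset α) (F : Multiset (Finset α))
    (h : ∀ B ∈ F, B.card = 3 ∧ B ⊆ X) :
    ∑ p ∈ X.powersetCard 2, lamF F p = 3 * Multiset.card F := by
  induction F using Multiset.induction_on with
  | empty => simp [lamF]
  | cons B F ih =>
    have h1 : ∀ p, lamF (B ::ₘ F) p = (if p ⊆ B then 1 else 0) + lamF F p := by
      intro p
      unfold lamF
      by_cases hp : p ⊆ B <;> simp [hp, add_comm]
    have h2 := h B (Multiset.mem_cons_self _ _)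
    have h3 : (X.powersetCard 2).filter (fun p => p ⊆ B) = B.powersetCard 2 := by
      ext p
      simp only [Finset.mem_filter, Finset.mem_powersetCard]
      constructor
      · rintro ⟨⟨_, h⟩, h'⟩
        exact ⟨h', h⟩
      · rintro ⟨h, h'⟩
        exact ⟨⟨h.trans h2.2, h'⟩, h⟩
    simp only [h1, Finset.sum_add_distrib]
    rw [ih (fun A hA => h A (Multiset.mem_cons_of_mem hA)), ← Finset.card_filter, h3,
      Finset.card_powersetCard, h2.1, Multiset.card_cons]
    have : Nat.choose 3 2 = 3 := rfl
    omega

theorem sum_defect (X : Finset α) (F : Multiset (Finset α)) (l : ℕ)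
    (h : PairRangeOn X F l) :
    ((∑ p ∈ X.powersetCard 2, lamF F p : ℕ) : ℤ) =
      (l : ℤ) * (X.card.choose 2 : ℤ) + (Dlev X F l 1).card - (Dlev X F l (-1)).card := by
  have h1 : ∀ p ∈ X.powersetCard 2, (lamF F p : ℤ) = (l : ℤ) +
      (if (lamF F p : ℤ) = (l : ℤ) + 1 then 1 else 0) -
      (if (lamF F p : ℤ) = (l : ℤ) + -1 then 1 else 0) := by
    intro p hp
    have := h p hp
    split_ifs <;> omega
  push_cast
  rw [Finset.sum_congr rfl h1, Finset.sum_sub_distrib, Finset.sum_add_distrib]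
  simp only [Dlev, Finset.sum_boole, Finset.sum_const, Finset.card_powersetCard, nsmul_eq_mul]
  ring

theorem shape_card (X : Finset α) (F : Multiset (Finset α)) (l : ℕ) (e : ℤ)
    (h : C1ShapeOn X F l e) :
    ((Dlev X F l 1).card : ℤ) - (Dlev X F l (-1)).card = e ∧
      (e = 1 ∨ e = -1 ∨ e = 2 ∨ e = -2) := by
  rcases h with ⟨h, _, h1, h2⟩ | ⟨h, _, h1, h2⟩ | ⟨h, _, h1, h2⟩ | ⟨h, _, h1, h2⟩ <;>
    · rw [h1, h2, h]; norm_num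

theorem assoc_unique (w c l l' : ℕ) (e e' : ℤ) (hw : 3 ≤ w)
    (h : AssocPair w c l e) (h' : AssocPair w c l' e') : l = l' ∧ e = e' := by
  obtain ⟨h1, h2, h3⟩ := h
  obtain ⟨h1', h2', h3'⟩ := h'
  have hw' : (3 : ℤ) ≤ w := by exact_mod_cast hw
  have hd : ((l : ℤ) - l') * ((w : ℤ) * (w - 1)) = 2 * e' - 2 * e := by linarith
  have hww : 2 * (w : ℤ) ≤ (w : ℤ) * (w - 1) := by nlinarith
  have hl : (l : ℤ) = l' := by
    have e1 : 2 * e' = ((w : ℤ) * (w - 1)) * (l - l') + 2 * e := by linarith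
    have even : ∃ k : ℤ, (w : ℤ) * (w - 1) = 2 * k := by
      rcases Int.even_mul_pred_self (w : ℤ) with ⟨k, hk⟩
      exact ⟨k, by linarith⟩
    obtain ⟨k, hk⟩ := even
    rw [hk] at hd hww
    have hk2 : ((l : ℤ) - l') * k = e' - e := by linarith
    by_contra hne
    rcases lt_or_gt_of_ne hne with hlt | hgt
    · have : (l : ℤ) - l' ≤ -1 := by omega
      nlinarith
    · have : (1 : ℤ) ≤ (l : ℤ) - l' := by omega
      nlinarith
  rw [hl] at hd
  refine ⟨by exact_mod_cast hl, by linarith⟩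

theorem triangle_map {β : Type*} [DecidableEq β] (f : β ↪ α) (D : Finset (Finset β))
    (h : IsTriangle D) : IsTriangle (D.map (Finset.mapEmbedding f).toEmbedding) := by
  obtain ⟨x, y, z, h1, h2, h3, rfl⟩ := h
  refine ⟨f x, f y, f z, f.injective.ne h1, f.injective.ne h2, f.injective.ne h3, ?_⟩
  simp [Finset.map_insert, Finset.mapEmbedding_apply]

theorem fourCycle_map {β : Type*} [DecidableEq β] (f : β ↪ α) (D : Finset (Finset β))
    (h : IsFourCycle D) : IsFourCycle (D.map (Finset.mapEmbedding f).toEmbedding) := by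
  obtain ⟨x, y, z, w, h1, h2, h3, h4, h5, h6, rfl⟩ := h
  refine ⟨f x, f y, f z, f w, f.injective.ne h1, f.injective.ne h2, f.injective.ne h3,
    f.injective.ne h4, f.injective.ne h5, f.injective.ne h6, ?_⟩
  simp [Finset.map_insert, Finset.mapEmbedding_apply]

theorem sub_map {β : Type*} [Fintype β] [DecidableEq β] (f : β ↪ α) (p : Finset α)
    (h : p ⊆ Finset.univ.map f) : ∃ p' : Finset β, p = p'.map f := by
  obtain ⟨u, -, rfl⟩ := Finset.subset_map_iff.1 h
  exact ⟨u, rfl⟩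

theorem Dlev_map {β : Type*} [Fintype α] [Fintype β] [DecidableEq β] (f : β ↪ α)
    (F : Multiset (Finset α)) (F0 : Multiset (Finset β)) (m lam : ℕ)
    (hin : ∀ p : Finset β, p.card = 2 → lamF F (p.map f) = m + lamF F0 p)
    (hout : ∀ p : Finset α, p.card = 2 → ¬ p ⊆ Finset.univ.map f → lamF F p = m + lam)
    (i : ℤ) (hi : i ≠ 0) :
    Dlev Finset.univ F (m + lam) i =
      (Dlev Finset.univ F0 lam i).map (Finset.mapEmbedding f).toEmbedding := by
  ext p
  simp only [Dlev, Finset.mem_filter, Finset.mem_powersetCard, Finset.subset_univ, true_and,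
    Finset.mem_map]
  constructor
  · rintro ⟨h1, h2⟩
    by_cases hp : p ⊆ Finset.univ.map f
    · obtain ⟨p', rfl⟩ := sub_map f p hp
      rw [Finset.card_map] at h1
      rw [hin p' h1] at h2
      refine ⟨p', ⟨h1, ?_⟩, rfl⟩
      push_cast at h2
      linarith
    · rw [hout p h1 hp] at h2
      exact absurd (by linarith) hi
  · rintro ⟨p', ⟨h1, h2⟩, rfl⟩
    have : (Finset.mapEmbedding f).toEmbedding p' = p'.map f := rfl
    rw [this, Finset.card_map, hin p' h1]
    refine ⟨h1, ?_⟩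
    push_cast
    linarith

theorem range_map {β : Type*} [Fintype α] [Fintype β] [DecidableEq β] (f : β ↪ α)
    (F : Multiset (Finset α)) (F0 : Multiset (Finset β)) (m lam : ℕ)
    (hin : ∀ p : Finset β, p.card = 2 → lamF F (p.map f) = m + lamF F0 p)
    (hout : ∀ p : Finset α, p.card = 2 → ¬ p ⊆ Finset.univ.map f → lamF F p = m + lam)
    (h : PairRangeOn Finset.univ F0 lam) : PairRangeOn Finset.univ F (m + lam) := by
  intro p hp
  have h1 := (Finset.mem_powersetCard.1 hp).2
  by_cases hpf : p ⊆ Finset.univ.map f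
  · obtain ⟨p', rfl⟩ := sub_map f p hpf
    rw [Finset.card_map] at h1
    rw [hin p' h1]
    have := h p' (Finset.mem_powersetCard.2 ⟨Finset.subset_univ _, h1⟩)
    push_cast
    constructor <;> linarith [this.1, this.2]
  · rw [hout p h1 hpf]
    constructor <;> linarith

theorem shape_map {β : Type*} [Fintype α] [Fintype β] [DecidableEq β] (f : β ↪ α)
    (F : Multiset (Finset α)) (F0 : Multiset (Finset β)) (m lam : ℕ) (e : ℤ)
    (hin : ∀ p : Finset β, p.card = 2 → lamF F (p.map f) = m + lamF F0 p)
    (hout : ∀ p : Finset α, p.card = 2 → ¬ p ⊆ Finset.univ.map f → lamF F p = m + lam)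
    (h : C1ShapeOn Finset.univ F0 lam e) : C1ShapeOn Finset.univ F (m + lam) e := by
  unfold C1ShapeOn at h ⊢
  rw [Dlev_map f F F0 m lam hin hout 1 (by norm_num),
    Dlev_map f F F0 m lam hin hout (-1) (by norm_num), ← Finset.map_union,
    Finset.card_map, Finset.card_map]
  rcases h with ⟨h, h', h1⟩ | ⟨h, h', h1⟩ | ⟨h, h', h1⟩ | ⟨h, h', h1⟩
  · exact Or.inl ⟨h, triangle_map f _ h', h1⟩
  · exact Or.inr (Or.inl ⟨h, triangle_map f _ h', h1⟩)
  · exact Or.inr (Or.inr (Or.inl ⟨h, fourCycle_map f _ h', h1⟩))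
  · exact Or.inr (Or.inr (Or.inr ⟨h, fourCycle_map f _ h', h1⟩))

/-- a 3-balanced system with fewer blocks than triples is simple on triples -/
theorem count_le_one_of {β : Type*} [Fintype β] [DecidableEq β] (F : Multiset (Finset β))
    (hb : ThreeBalancedOn Finset.univ F)
    (hc : Multiset.card F < (Fintype.card β).choose 3) (T : Finset β) (hT : T.card = 3) :
    F.count T ≤ 1 := by
  have : ∃ T0 ∈ (Finset.univ : Finset β).powersetCard 3, F.count T0 = 0 := by
    by_contra hcon
    push Not at hcon
    have h1 : (Finset.univ : Finset β).powersetCard 3 ⊆ F.toFinset := by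
      intro T0 h0
      rw [Multiset.mem_toFinset]
      exact Multiset.count_ne_zero.1 (hcon T0 h0)
    have h2 := Finset.card_le_card h1
    rw [Finset.card_powersetCard, Finset.card_univ] at h2
    have := Multiset.toFinset_card_le F
    omega
  obtain ⟨T0, h0, h00⟩ := this
  have := hb T (Finset.mem_powersetCard.2 ⟨Finset.subset_univ _, hT⟩) T0 h0
  omega

theorem gdd_lam (X U : Finset α) (mu u : ℕ) (B : Multiset (Finset α))
    (h : IsGDD1u X mu u U B) (p : Finset α) (hp : p ∈ X.powersetCard 2) :
    lamF B p = if p ⊆ U then 0 else mu := by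
  split_ifs with hU
  · apply lamF_zero_of
    intro A hA hpA
    have h1 := (h.2.2.1 A hA).2.2
    have h2 := Finset.card_le_card (Finset.subset_inter hpA hU)
    rw [(Finset.mem_powersetCard.1 hp).2] at h2
    omega
  · exact h.2.2.2 p hp hU

theorem filled_lam {β ι : Type*} [Fintype α] [Fintype β] [DecidableEq β] (f : β ↪ α)
    (U : Finset α) (hU : Finset.univ.map f = U) (Q : Multiset (Finset β)) (s : Finset ι)
    (P : ι → Multiset (Finset α)) (u : ℕ)
    (hP : ∀ i ∈ s, IsGDD1u Finset.univ 2 u U (P i)) (p : Finset α) (hp : p.card = 2) :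
    (∀ p' : Finset β, p = p'.map f →
      lamF (Q.map (Finset.map f) + ∑ i ∈ s, P i) p = lamF Q p') ∧
    (¬ p ⊆ U → lamF (Q.map (Finset.map f) + ∑ i ∈ s, P i) p = 2 * s.card) := by
  have hp' : p ∈ (Finset.univ : Finset α).powersetCard 2 :=
    Finset.mem_powersetCard.2 ⟨Finset.subset_univ _, hp⟩
  rw [lamF_add', lamF_sum',
    Finset.sum_congr rfl (fun i hi => gdd_lam _ _ _ _ _ (hP i hi) p hp')]
  constructor
  · rintro p' rfl
    have : p'.map f ⊆ U := by
      rw [← hU]; exact Finset.map_subset_map.2 (Finset.subset_univ _)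
    simp [this, lamF_map']
  · intro h
    rw [lamF_zero_of]
    · simp [h, mul_comm]
    · intro B hB hpB
      obtain ⟨B', _, rfl⟩ := Multiset.mem_map.1 hB
      apply h
      rw [← hU]
      exact hpB.trans (Finset.map_subset_map.2 (Finset.subset_univ _))

/-- arithmetic of the parameters -/
theorem final_arith (v b' q lam C : ℕ) (e : ℤ) (hv6 : v % 6 = 2) (hlam : lam = 2 ∨ lam = 4)
    (he : e = 1 ∨ e = -1 ∨ e = 2 ∨ e = -2) (hb1 : -(v : ℤ) < 2 * e) (hb2 : 2 * e < (v : ℤ))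
    (hb' : 3 * (b' : ℤ) = (lam : ℤ) * (v.choose 2 : ℤ) + e)
    (hsum : ((3 * C : ℕ) : ℤ) = ((6 * q + lam : ℕ) : ℤ) * (v.choose 2 : ℤ) + e) :
    AssocPair v (q * (v * (v - 1)) + b') (6 * q + lam) e ∧
    C = q * (v * (v - 1)) + b' ∧ CondC1 v (q * (v * (v - 1)) + b') := by
  have hch : ((v).choose 2 : ℤ) * 2 =
      ((v : ℕ) : ℤ) * (((v : ℕ) : ℤ) - 1) := by
    have h1 := Nat.choose_two_right (v)
    have h2 := Nat.div_mul_cancel (Nat.even_mul_pred_self (v)).two_dvd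
    rw [← h1] at h2
    have h3 : ((v - 1 : ℕ) : ℤ) = ((v : ℕ) : ℤ) - 1 := by
      omega
    rw [← h3]
    exact_mod_cast h2
  have hv1 : ((v - 1 : ℕ) : ℤ) = ((v : ℕ) : ℤ) - 1 := by
    omega
  have hAP : AssocPair v (q * (v * (v - 1)) + b') (6 * q + lam) e := by
    refine ⟨?_, hb1, hb2⟩
    push_cast
    rw [hv1]
    linear_combination 2 * hb' + lam * hch
  refine ⟨hAP, ?_, by omega, 6 * q + lam, by omega, Or.inr ⟨hv6, by omega⟩, ?_⟩
  · have h1 := hAP.1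
    have h2 : 6 * (C : ℤ) = 6 * ((q * (v * (v - 1)) + b' : ℕ) : ℤ) := by
      rw [h1]
      push_cast at hsum ⊢
      linear_combination 2 * hsum + (6 * q + lam) * hch
    omega
  · have h1 := hAP.1
    rw [← hv1] at h1
    generalize q * (v * (v - 1)) + b' = b at *
    have h2 : (6 : ℤ) * b = (((6 * q + lam) * v * (v - 1) : ℕ) : ℤ) + 2 * e := by
      rw [h1]; push_cast; ring
    generalize (6 * q + lam) * v * (v - 1) = z at *
    omega

/-- Construction via a g-PCS_2((2ag)^n : 2). -/
theorem stmt_7 (a g n c lam : ℕ) (e : ℤ)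
    (ha : 1 ≤ a) (hg3 : g % 3 = 0) (hg : 3 ≤ g) (hn : 3 ≤ n)
    (hlam : lam = 2 ∨ lam = 4)
    (hPCS : ∃ (S : Finset (Fin (2 * a * g * n + 2)))
        (G : Fin n → Finset (Fin (2 * a * g * n + 2)))
        (A : Multiset (Finset (Fin (2 * a * g * n + 2)))),
        IsGPCS2 Finset.univ a g n 2 S G A)
    (hS6 : ∃ B : Multiset (Finset (Fin (2 * a * g + 2))),
        B.Nodup ∧ IsSDesignOn Finset.univ 6 B)
    (hC1 : CondC1 (2 * a * g + 2) c) (hassoc : AssocPair (2 * a * g + 2) c lam e)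
    (hNW : ∃ F : Multiset (Finset (Fin (2 * a * g + 2))),
        IsNWBTSOn Finset.univ (2 * a * g + 2) c F) :
    ∀ q : ℕ, q ≤ n - 1 →
      ∀ b' : ℕ, 3 * (b' : ℤ) = (lam : ℤ) * ((2 * a * g * n + 2).choose 2 : ℤ) + e →
        ∃ F : Multiset (Finset (Fin (2 * a * g * n + 2))),
          IsNWBTSOn Finset.univ (2 * a * g * n + 2)
            (q * ((2 * a * g * n + 2) * (2 * a * g * n + 2 - 1)) + b') F := by
  intro q hq b' hb'
  obtain ⟨S, G, A, hCS, P, grp, hPA, hgrp, hP⟩ := hPCS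
  obtain ⟨hS, -, hG, hGdisj, hGS, -, hA3, hA1, hA0⟩ := hCS
  obtain ⟨B6, hB6n, hB6, hB6lam⟩ := hS6
  obtain ⟨F0, ⟨-, hF0c, hF03⟩, hF0b, l, e0, hl, has0, hrange, hshape⟩ := hNW
  have hag : 3 ≤ a * g := by nlinarith
  have hw8 : 8 ≤ 2 * a * g + 2 := by nlinarith
  obtain ⟨rfl, rfl⟩ := assoc_unique _ c lam l e e0 (by omega) hassoc has0
  have hC1s : C1ShapeOn Finset.univ F0 lam e := by
    rcases hshape with h | ⟨⟨-, l2, -, hodd, h1, h2⟩, -⟩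
    · exact h.2
    · exfalso
      obtain ⟨d, hd⟩ : ∃ d : ℤ, 6 * (c : ℤ) = (l2 : ℤ) * (2 * a * g + 2 : ℕ) *
          (((2 * a * g + 2 : ℕ) : ℤ) - 1) + 2 * d := by
        obtain ⟨k, hk⟩ := Int.even_mul_pred_self ((2 * a * g + 2 : ℕ) : ℤ)
        exact ⟨3 * c - l2 * k, by rw [mul_assoc, hk]; ring⟩
      have := (assoc_unique (2 * a * g + 2) c lam l2 e d (by omega) hassoc
        ⟨hd, by linarith, by linarith⟩).1
      omega
  obtain ⟨hcard, he⟩ := shape_card _ _ _ _ hC1s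
  -- simplicity of F0
  have hF0s : ∀ T : Finset (Fin (2 * a * g + 2)), T.card = 3 → F0.count T ≤ 1 := by
    apply count_le_one_of F0 hF0b
    rw [hF0c, Fintype.card_fin]
    obtain ⟨h1, h2, h3⟩ := hassoc
    have h4 : ((2 * a * g + 2).choose 3) * 6 =
        (2 * a * g + 2) * (2 * a * g + 1) * (2 * a * g) := by
      have := Nat.descFactorial_eq_factorial_mul_choose (2 * a * g + 2) 3
      simp [Nat.descFactorial_succ, Nat.factorial] at this
      rw [mul_comm, ← this]
      ring
    generalize (2 * a * g + 2).choose 3 = C at *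
    generalize hm : 2 * a * g = m at *
    zify at h4 hw8 ⊢
    push_cast at h1 h2 h3
    have h6 : (lam : ℤ) ≤ 4 := by rcases hlam with rfl | rfl <;> norm_num
    have h7 : (lam : ℤ) * ((m + 2) * (m + 1)) ≤ 4 * ((m + 2) * (m + 1)) :=
      mul_le_mul_of_nonneg_right h6 (by positivity)
    have h8 : 6 * (((m : ℤ) + 2) * (m + 1)) ≤ m * ((m + 2) * (m + 1)) :=
      mul_le_mul_of_nonneg_right (by linarith) (by positivity)
    nlinarith
  -- embeddings
  have hUcard : ∀ j, (G j ∪ S).card = 2 * a * g + 2 := by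
    intro j
    rw [Finset.card_union_of_disjoint (hGS j), (hG j).1, hS]
  have hf : ∀ j, ∃ f : Fin (2 * a * g + 2) ↪ Fin (2 * a * g * n + 2),
      Finset.univ.map f = G j ∪ S := fun j =>
    ⟨((G j ∪ S).orderEmbOfFin (hUcard j)).toEmbedding, by simp⟩
  choose f hf using hf
  let j0 : Fin n := ⟨0, by omega⟩
  obtain ⟨J, hJ, hJq⟩ : ∃ J ⊆ (Finset.univ : Finset (Fin n)).erase j0, J.card = q := by
    apply Finset.exists_subset_card_eq
    rw [Finset.card_erase_of_mem (Finset.mem_univ _), Finset.card_univ, Fintype.card_fin]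
    exact hq
  have hJ0 : j0 ∉ J := fun h => by simpa using hJ h
  have ht : ∀ j, ∃ t : Finset (Fin (g * n)), (∀ i ∈ t, grp i = j) ∧
      t.card = if j = j0 then lam / 2 else 3 := by
    intro j
    have : (if j = j0 then lam / 2 else 3) ≤
        (Finset.univ.filter fun i => grp i = j).card := by
      rw [hgrp]; split_ifs <;> omega
    obtain ⟨t, h1, h2⟩ := Finset.exists_subset_card_eq this
    exact ⟨t, fun i hi => (Finset.mem_filter.1 (h1 hi)).2, h2⟩
  choose t htg htc using ht
  have htP : ∀ j, ∀ i ∈ t j, IsGDD1u Finset.univ 2 (2 * a * g + 2) (G j ∪ S) (P i) := by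
    intro j i hi
    have := hP i
    rwa [htg j i hi] at this
  let Q : Fin n → Multiset (Finset (Fin (2 * a * g + 2))) := fun j => if j = j0 then F0 else B6
  have hQ3 : ∀ j, ∀ B ∈ Q j, B.card = 3 := by
    intro j B hB
    by_cases h : j = j0
    · simp only [Q, h, if_true] at hB
      exact (hF03 B hB).1
    · simp only [Q, h, if_false] at hB
      exact (hB6 B hB).1
  have hQ1 : ∀ j, ∀ T : Finset (Fin (2 * a * g + 2)), T.card = 3 → (Q j).count T ≤ 1 := by
    intro j T hT
    by_cases h : j = j0
    · simp only [Q, h, if_true]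
      exact hF0s T hT
    · simp only [Q, h, if_false]
      exact Multiset.nodup_iff_count_le_one.1 hB6n T
  let R : Fin n → Multiset (Finset (Fin (2 * a * g * n + 2))) :=
    fun j => (Q j).map (Finset.map (f j)) + ∑ i ∈ t j, P i
  let K : Finset (Fin n) := insert j0 J
  let F : Multiset (Finset (Fin (2 * a * g * n + 2))) := ∑ j ∈ K, R j
  have hR := fun j => filled_lam (f j) _ (hf j) (Q j) (t j) P (2 * a * g + 2) (htP j)
  have hR6 : ∀ j ∈ J, ∀ p : Finset (Fin (2 * a * g * n + 2)), p.card = 2 →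
      lamF (R j) p = 6 := by
    intro j hj p hp
    have hne : j ≠ j0 := fun h => hJ0 (h ▸ hj)
    by_cases h : p ⊆ G j ∪ S
    · rw [← hf j] at h
      obtain ⟨p', rfl⟩ := sub_map _ _ h
      have h1 := (hR j _ hp).1 p' rfl
      have h2 : Q j = B6 := by simp [Q, hne]
      rw [h2] at h1
      simp only [R, h2]
      rw [h1]
      rw [Finset.card_map] at hp
      exact hB6lam p' (Finset.mem_powersetCard.2 ⟨Finset.subset_univ _, hp⟩)
    · have h1 := (hR j _ hp).2 h
      simp only [R]
      rw [h1, htc, if_neg hne]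
  have hFlam : ∀ p : Finset (Fin (2 * a * g * n + 2)), p.card = 2 →
      lamF F p = 6 * q + lamF (R j0) p := by
    intro p hp
    simp only [F, K]
    rw [lamF_sum', Finset.sum_insert hJ0, Finset.sum_congr rfl (fun j hj => hR6 j hj p hp)]
    simp [hJq]
    ring
  have hQ0 : Q j0 = F0 := by simp [Q]
  have hin : ∀ p : Finset (Fin (2 * a * g + 2)), p.card = 2 →
      lamF F (p.map (f j0)) = 6 * q + lamF F0 p := by
    intro p hp
    have hp' : (p.map (f j0)).card = 2 := by rw [Finset.card_map, hp]
    rw [hFlam _ hp', ← hQ0]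
    congr 1
    exact (hR j0 _ hp').1 p rfl
  have hout : ∀ p : Finset (Fin (2 * a * g * n + 2)), p.card = 2 →
      ¬ p ⊆ Finset.univ.map (f j0) → lamF F p = 6 * q + lam := by
    intro p hp hn'
    rw [hf] at hn'
    rw [hFlam p hp]
    have := (hR j0 _ hp).2 hn'
    rw [htc, if_pos rfl] at this
    simp only [R]
    rw [this]
    omega
  -- the blocks
  have hPA' : ∀ i, P i ≤ A := fun i =>
    (Finset.single_le_sum (f := P) (fun _ _ => Multiset.zero_le _) (Finset.mem_univ i)).trans hPA
  have hF3 : ∀ B ∈ F, B.card = 3 ∧ B ⊆ Finset.univ := by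
    intro B hB
    refine ⟨?_, Finset.subset_univ _⟩
    obtain ⟨j, -, hj⟩ := Multiset.mem_sum.1 hB
    rcases Multiset.mem_add.1 hj with h | h
    · obtain ⟨B', hB', rfl⟩ := Multiset.mem_map.1 h
      rw [Finset.card_map]
      exact hQ3 j B' hB'
    · obtain ⟨i, -, hi⟩ := Multiset.mem_sum.1 h
      exact (hA3 B (Multiset.mem_of_le (hPA' i) hi)).1
  -- counts
  have hQcount : ∀ j, ∀ T : Finset (Fin (2 * a * g * n + 2)), T.card = 3 →
      ((Q j).map (Finset.map (f j))).count T ≤ if T ⊆ G j ∪ S then 1 else 0 := by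
    intro j T hT
    split_ifs with h
    · rw [← hf j] at h
      obtain ⟨T', rfl⟩ := sub_map _ _ h
      rw [Multiset.count_map_eq_count' _ _ (Finset.map_injective (f j))]
      rw [Finset.card_map] at hT
      exact hQ1 j T' hT
    · rw [Nat.le_zero, Multiset.count_eq_zero]
      intro hmem
      obtain ⟨T', -, rfl⟩ := Multiset.mem_map.1 hmem
      apply h
      rw [← hf j]
      exact Finset.map_subset_map.2 (Finset.subset_univ _)
  have hparts : ∑ j ∈ K, ∑ i ∈ t j, P i ≤ A := by
    refine le_trans ?_ hPA
    rw [← Finset.sum_biUnion]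
    · exact Finset.sum_le_sum_of_subset (Finset.subset_univ _)
    · intro x _ y _ hxy
      rw [Function.onFun, Finset.disjoint_left]
      intro i hi hi'
      exact hxy ((htg x i hi).symm.trans (htg y i hi'))
  have hFeq : F = ∑ j ∈ K, (Q j).map (Finset.map (f j)) + ∑ j ∈ K, ∑ i ∈ t j, P i :=
    Finset.sum_add_distrib
  have hAc : ∀ T, A.count T ≤ lamF A T := by
    intro T
    rw [lamF, Multiset.count, Multiset.countP_eq_card_filter]
    exact Multiset.card_le_card
      (Multiset.monotone_filter_right _ (fun B (h : T = B) => h ▸ Finset.Subset.refl _))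
  have hsimple : ∀ T : Finset (Fin (2 * a * g * n + 2)), T.card = 3 → F.count T ≤ 1 := by
    intro T hT
    have hTm : T ∈ (Finset.univ : Finset (Fin (2 * a * g * n + 2))).powersetCard 3 :=
      Finset.mem_powersetCard.2 ⟨Finset.subset_univ _, hT⟩
    have h1 := (Multiset.count_le_of_le T hparts).trans (hAc T)
    rw [hFeq, Multiset.count_add, Multiset.count_sum']
    have h2 := Finset.sum_le_sum (fun j (_ : j ∈ K) => hQcount j T hT)
    by_cases h : ∃ i, T ⊆ G i ∪ S
    · obtain ⟨i, hi⟩ := h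
      rw [hA0 T hTm ⟨i, by rwa [Finset.union_comm]⟩] at h1
      have h3 : ∑ j ∈ K, (if T ⊆ G j ∪ S then 1 else 0) ≤ 1 := by
        rw [← Finset.card_filter, Finset.card_le_one]
        intro x hx y hy
        by_contra hxy
        have hx' := (Finset.mem_filter.1 hx).2
        have hy' := (Finset.mem_filter.1 hy).2
        have : T ⊆ S := by
          intro z hz
          rcases Finset.mem_union.1 (hx' hz) with h | h
          · rcases Finset.mem_union.1 (hy' hz) with h' | h'
            · exact absurd h' (Finset.disjoint_left.1 (hGdisj x y hxy) h)
            · exact h'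
          · exact h
        have := Finset.card_le_card this
        omega
      omega
    · push Not at h
      rw [hA1 T hTm (fun i => by rw [Finset.union_comm]; exact h i)] at h1
      have h3 : ∑ j ∈ K, (if T ⊆ G j ∪ S then 1 else 0) = 0 :=
        Finset.sum_eq_zero (fun j _ => by simp [h j])
      omega
  -- conclusion
  have hrangeF := range_map (f j0) F F0 (6 * q) lam hin hout hrange
  have hshapeF := shape_map (f j0) F F0 (6 * q) lam e hin hout hC1s
  have hsum := sum_defect _ _ _ hrangeF
  rw [double_count _ _ hF3, Finset.card_univ, Fintype.card_fin, add_sub_assoc,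
    (shape_card _ _ _ _ hshapeF).1] at hsum
  have hagn : 2 * a * g ≤ 2 * a * g * n := Nat.le_mul_of_pos_right _ (by omega)
  have hv6 : (2 * a * g * n + 2) % 6 = 2 := by
    obtain ⟨k, rfl⟩ : ∃ k, g = 3 * k := ⟨g / 3, by omega⟩
    have : 2 * a * (3 * k) * n = 6 * (a * k * n) := by ring
    omega
  obtain ⟨hAP, hFcard, hC1v⟩ := final_arith (2 * a * g * n + 2) b' q lam (Multiset.card F) e
    hv6 hlam he (by have := hassoc.2.1; omega) (by have := hassoc.2.2; omega) hb' hsum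
  refine ⟨F, ⟨by simp, hFcard, hF3⟩, ?_, 6 * q + lam, e, by omega, hAP, hrangeF,
    Or.inl ⟨hC1v, hshapeF⟩⟩
  intro T1 h1 T2 _
  have := hsimple T1 (Finset.mem_powersetCard.1 h1).2
  omega

end DataPlacement
end

section
/- For every odd positive integer n, there exists a 1-FG(3,({3,5},{4,6}),n) of type 1^n. -/
namespace DataPlacement

open Finset

variable {α : Type*} [DecidableEq α]

/-- `B` is an S(3,{4,6},·) on the point set `P`. -/
def SysOn {W : Type*} (P : Finset W) (B : Set (Finset W)) : Prop :=
  (∀ b ∈ B, (b.card = 4 ∨ b.card = 6) ∧ b ⊆ P) ∧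
  ∀ x ∈ P, ∀ y ∈ P, ∀ z ∈ P, x ≠ y → x ≠ z → y ≠ z →
    ∃! b, b ∈ B ∧ x ∈ b ∧ y ∈ b ∧ z ∈ b

/-- An S(3,{4,6},m) exists. -/
def HasS (m : ℕ) : Prop := ∃ B : Set (Finset (Fin m)), SysOn Finset.univ B

lemma SysOn.map {U W : Type*} [Fintype U] (g : U ↪ W) {B : Set (Finset U)}
    (h : SysOn Finset.univ B) :
    SysOn (Finset.univ.map g) ((fun b => b.map g) '' B) := by
  obtain ⟨h1, h2⟩ := h
  refine ⟨?_, ?_⟩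
  · rintro _ ⟨b, hb, rfl⟩
    refine ⟨by simpa using (h1 b hb).1, ?_⟩
    exact Finset.map_subset_map.2 (Finset.subset_univ _)
  · intro x hx y hy z hz hxy hxz hyz
    obtain ⟨x, -, rfl⟩ := Finset.mem_map.1 hx
    obtain ⟨y, -, rfl⟩ := Finset.mem_map.1 hy
    obtain ⟨z, -, rfl⟩ := Finset.mem_map.1 hz
    obtain ⟨b, hb, hu⟩ := h2 x (mem_univ _) y (mem_univ _) z (mem_univ _)
      (fun h => hxy (by rw [h])) (fun h => hxz (by rw [h])) (fun h => hyz (by rw [h]))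
    refine ⟨b.map g, ⟨⟨b, hb.1, rfl⟩, by simpa using hb.2⟩, ?_⟩
    rintro _ ⟨⟨b', hb', rfl⟩, h3⟩
    have := hu b' ⟨hb', by simpa using h3⟩
    simp [this]

lemma HasS.onFinset {W : Type*} {m : ℕ} (h : HasS m) (Q : Finset W) (hQ : Q.card = m) :
    ∃ B, SysOn Q B := by
  obtain ⟨B, hB⟩ := h
  let e := (Q.equivFinOfCardEq hQ).symm
  have := hB.map (e.toEmbedding.trans (Function.Embedding.subtype _))
  have hQ' : Finset.univ.map (e.toEmbedding.trans (Function.Embedding.subtype _)) = Q := by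
    ext x
    simp only [Finset.mem_map, Finset.mem_univ, true_and]
    constructor
    · rintro ⟨i, rfl⟩
      exact (e i).2
    · intro hx
      exact ⟨e.symm ⟨x, hx⟩, by simp⟩
  rw [hQ'] at this
  exact ⟨_, this⟩

lemma HasS.of_sys {U : Type*} [Fintype U] {B : Set (Finset U)} {m : ℕ}
    (h : SysOn Finset.univ B) (hm : Fintype.card U = m) : HasS m := by
  have := h.map (Fintype.equivFinOfCardEq hm).toEmbedding
  exact ⟨_, by simpa using this⟩

lemma HasS.on {m : ℕ} (h : HasS m) (U : Type*) [Fintype U] (hm : Fintype.card U = m) :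
    ∃ B : Set (Finset U), SysOn Finset.univ B :=
  h.onFinset _ (by simpa using hm)

lemma hasS_two : HasS 2 :=
  ⟨∅, by simp, by
    intro x _ y _ z _ h1 h2 h3
    omega⟩

lemma hasS_single (m : ℕ) (hm : m = 4 ∨ m = 6) : HasS m :=
  ⟨{Finset.univ}, by simpa using hm, by
    intro x _ y _ z _ h1 h2 h3
    exact ⟨Finset.univ, by simp, by simp⟩⟩

/-- The cyclic SQS(10). -/
def sqs10 : Finset (Finset (Fin 10)) :=
  (Finset.univ.image fun i : Fin 10 => ({i, i + 1, i + 3, i + 4} : Finset (Fin 10))) ∪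
  (Finset.univ.image fun i : Fin 10 => ({i, i + 1, i + 2, i + 6} : Finset (Fin 10))) ∪
  (Finset.univ.image fun i : Fin 10 => ({i, i + 2, i + 4, i + 7} : Finset (Fin 10)))

lemma hasS_ten : HasS 10 := by
  refine ⟨(sqs10 : Set (Finset (Fin 10))), ?_, ?_⟩
  · have : ∀ b ∈ sqs10, b.card = 4 := by decide +kernel
    intro b hb
    exact ⟨Or.inl (this b hb), Finset.subset_univ _⟩
  · have h1 : ∀ x y z : Fin 10, x ≠ y → x ≠ z → y ≠ z →
        ∃ b ∈ sqs10, x ∈ b ∧ y ∈ b ∧ z ∈ b := by decide +kernel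
    have h2 : ∀ b ∈ sqs10, ∀ b' ∈ sqs10, (b ∩ b').card ≤ 2 ∨ b' = b := by decide +kernel
    intro x _ y _ z _ hxy hxz hyz
    obtain ⟨b, hb, hx, hy, hz⟩ := h1 x y z hxy hxz hyz
    refine ⟨b, ⟨hb, hx, hy, hz⟩, ?_⟩
    rintro b' ⟨hb', hx', hy', hz'⟩
    rcases h2 b hb b' hb' with h | h
    · exfalso
      have h3 : ({x, y, z} : Finset (Fin 10)).card = 3 := Finset.card_eq_three.2
        ⟨x, y, z, hxy, hxz, hyz, rfl⟩
      have h4 : ({x, y, z} : Finset (Fin 10)) ⊆ b ∩ b' := by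
        intro w hw
        simp only [Finset.mem_insert, Finset.mem_singleton] at hw
        rcases hw with rfl | rfl | rfl <;> simp [*]
      have := Finset.card_le_card h4
      omega
    · exact h

lemma bool_flip : ∀ {i j : Bool}, ¬ i = j → j = !i := by decide

lemma mixed_rep {V I : Type*} [DecidableEq V] (f : V → V → I) (hf : ∀ a b, f a b = f b a)
    (A1 : Set (Finset V)) {p q r t : V} {j : Bool} (hpq : p ≠ q) (hrt : r ≠ t)
    (hff : f p q = f r t) (hno : ∀ L ∈ A1, p ∈ L → q ∈ L → r ∈ L → t ∉ L)
    {a b c : V} {i : Bool} (hab : a ≠ b)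
    (h1 : (a, i) ∈ ({(p, j), (q, j), (r, !j), (t, !j)} : Finset (V × Bool)))
    (h2 : (b, i) ∈ ({(p, j), (q, j), (r, !j), (t, !j)} : Finset (V × Bool)))
    (h3 : (c, !i) ∈ ({(p, j), (q, j), (r, !j), (t, !j)} : Finset (V × Bool))) :
    ∃ d, c ≠ d ∧ f c d = f a b ∧ (∀ L ∈ A1, a ∈ L → b ∈ L → c ∈ L → d ∉ L) ∧
      ({(p, j), (q, j), (r, !j), (t, !j)} : Finset (V × Bool)) =
        {(a, i), (b, i), (c, !i), (d, !i)} := by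
  simp only [Finset.mem_insert, Finset.mem_singleton, Prod.mk.injEq] at h1 h2 h3
  have key : ∀ p q r t : V, p ≠ q → r ≠ t → f p q = f r t →
      (∀ L ∈ A1, p ∈ L → q ∈ L → r ∈ L → t ∉ L) →
      (a = p ∨ a = q) → (b = p ∨ b = q) → (c = r ∨ c = t) →
      ∃ d, c ≠ d ∧ f c d = f a b ∧ (∀ L ∈ A1, a ∈ L → b ∈ L → c ∈ L → d ∉ L) ∧
      ({(p, i), (q, i), (r, !i), (t, !i)} : Finset (V × Bool)) =
        {(a, i), (b, i), (c, !i), (d, !i)} := by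
    clear h1 h2 h3 hpq hrt hff hno p q r t
    intro p q r t hpq hrt hff hno h1 h2 h3
    have hab' : (a = p ∧ b = q) ∨ (a = q ∧ b = p) := by grind
    rcases h3 with rfl | rfl
    · refine ⟨t, hrt, ?_, ?_, ?_⟩
      · rcases hab' with ⟨rfl, rfl⟩ | ⟨rfl, rfl⟩
        · exact hff.symm
        · rw [← hff, hf]
      · rcases hab' with ⟨rfl, rfl⟩ | ⟨rfl, rfl⟩
        · exact hno
        · exact fun L hL h h' => hno L hL h' h
      · rcases hab' with ⟨rfl, rfl⟩ | ⟨rfl, rfl⟩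
        · rfl
        · ext w; simp only [Finset.mem_insert, Finset.mem_singleton]; tauto
    · refine ⟨r, hrt.symm, ?_, ?_, ?_⟩
      · rcases hab' with ⟨rfl, rfl⟩ | ⟨rfl, rfl⟩
        · rw [hff, hf]
        · rw [hf, ← hff, hf]
      · rcases hab' with ⟨rfl, rfl⟩ | ⟨rfl, rfl⟩
        · exact fun L hL h h' h3 h4 => hno L hL h h' h4 h3
        · exact fun L hL h h' h3 h4 => hno L hL h' h h4 h3
      · rcases hab' with ⟨rfl, rfl⟩ | ⟨rfl, rfl⟩ <;>
        · ext w; simp only [Finset.mem_insert, Finset.mem_singleton]; tauto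
  by_cases hij : i = j
  · subst hij
    exact key p q r t hpq hrt hff hno (by simpa using h1) (by simpa using h2) (by simpa using h3)
  · have hij' : j = !i := bool_flip hij
    subst hij'
    obtain ⟨d, e1, e2, e3, e4⟩ := key r t p q hrt hpq hff.symm
      (fun L hL x1 x2 x3 x4 => hno L hL x3 x4 x1 x2)
      (by simpa using h1) (by simpa using h2) (by simpa using h3)
    refine ⟨d, e1, e2, e3, ?_⟩
    rw [← e4, Bool.not_not]
    clear e4 e1 e2 e3 h1 h2 h3 key hno hff hij hpq hrt hab hf
    ext w; simp only [Finset.mem_insert, Finset.mem_singleton]; tauto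

/-- The general doubling step. -/
lemma double_step {V I : Type*} [Fintype V] [DecidableEq V] (A1 AT : Set (Finset V))
    (S : Finset V → Set (Finset (V × Bool))) (f : V → V → I)
    (hpair : ∀ x y, x ≠ y → ∃ L ∈ A1, x ∈ L ∧ y ∈ L)
    (hpair' : ∀ x y, x ≠ y → ∀ L ∈ A1, ∀ L' ∈ A1, x ∈ L → y ∈ L → x ∈ L' → y ∈ L' → L = L')
    (hcard : ∀ b ∈ AT, b.card = 4 ∨ b.card = 6)
    (htr : ∀ x y z, x ≠ y → x ≠ z → y ≠ z → (∀ L ∈ A1, x ∈ L → y ∈ L → z ∉ L) →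
      ∃! b, b ∈ AT ∧ x ∈ b ∧ y ∈ b ∧ z ∈ b)
    (htr' : ∀ x y z, x ≠ y → x ≠ z → y ≠ z → ∀ L ∈ A1, x ∈ L → y ∈ L → z ∈ L →
      ∀ b ∈ AT, x ∈ b → y ∈ b → z ∉ b)
    (hS : ∀ L ∈ A1, SysOn (L ×ˢ Finset.univ) (S L))
    (hf : ∀ a b, f a b = f b a)
    (H1 : ∀ L ∈ A1, ∀ a ∈ L, ∀ b ∈ L, a ≠ b → ∀ c, c ∉ L → ∃! d, c ≠ d ∧ f c d = f a b)
    (H2 : ∀ L ∈ A1, ∀ a ∈ L, ∀ b ∈ L, ∀ c ∈ L, ∀ d, a ≠ b → c ≠ d → f a b = f c d → d ∈ L) :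
    ∃ B : Set (Finset (V × Bool)), SysOn Finset.univ B := by
  let M : Set (Finset (V × Bool)) := {s | ∃ a b c d i, a ≠ b ∧ c ≠ d ∧ f a b = f c d ∧
    (∀ L ∈ A1, a ∈ L → b ∈ L → c ∈ L → d ∉ L) ∧
    s = {(a, i), (b, i), (c, !i), (d, !i)}}
  let Pu : Set (Finset (V × Bool)) := {s | ∃ b ∈ AT, ∃ i, s = b ×ˢ {i}}
  let Q : Set (Finset (V × Bool)) := {s | ∃ L ∈ A1, s ∈ S L}
  have hSsub : ∀ L ∈ A1, ∀ s ∈ S L, ∀ p ∈ s, p.1 ∈ L := by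
    intro L hL s hs p hp
    have := ((hS L hL).1 s hs).2 hp
    simpa using this
  have pure : ∀ i x y z, x ≠ y → x ≠ z → y ≠ z →
      ∃! s, s ∈ M ∪ Pu ∪ Q ∧ (x, i) ∈ s ∧ (y, i) ∈ s ∧ (z, i) ∈ s := by
    intro i x y z hxy hxz hyz
    have nM : ∀ s ∈ M, (x, i) ∈ s → (y, i) ∈ s → (z, i) ∈ s → False := by
      rintro s ⟨a, b, c, d, j, -, -, -, -, rfl⟩ h1 h2 h3
      simp only [Finset.mem_insert, Finset.mem_singleton, Prod.mk.injEq] at h1 h2 h3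
      clear hpair hpair' htr htr' hS H1 H2 hSsub hcard hf
      cases i <;> cases j <;> simp at h1 h2 h3 <;> grind
    by_cases hL : ∃ L ∈ A1, x ∈ L ∧ y ∈ L ∧ z ∈ L
    · obtain ⟨L, hL, hx, hy, hz⟩ := hL
      obtain ⟨s, hs, hu⟩ := (hS L hL).2 (x, i) (by simpa) (y, i) (by simpa) (z, i) (by simpa)
        (by simpa) (by simpa) (by simpa)
      refine ⟨s, ⟨Or.inr ⟨L, hL, hs.1⟩, hs.2⟩, ?_⟩
      rintro s' ⟨(h | ⟨b, hb, j, rfl⟩) | ⟨L', hL', h⟩, h1, h2, h3⟩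
      · exact (nM s' h h1 h2 h3).elim
      · simp only [Finset.mem_product] at h1 h2 h3
        exact (htr' x y z hxy hxz hyz L hL hx hy hz b hb h1.1 h2.1 h3.1).elim
      · have : L' = L := hpair' x y hxy L' hL' L hL (hSsub _ hL' _ h _ h1)
          (hSsub _ hL' _ h _ h2) hx hy
        subst this
        exact hu s' ⟨h, h1, h2, h3⟩
    · push Not at hL
      obtain ⟨b, hb, hu⟩ := htr x y z hxy hxz hyz hL
      refine ⟨b ×ˢ {i}, ⟨Or.inl (Or.inr ⟨b, hb.1, i, rfl⟩), by simpa using hb.2⟩, ?_⟩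
      rintro s' ⟨(h | ⟨b', hb', j, rfl⟩) | ⟨L', hL', h⟩, h1, h2, h3⟩
      · exact (nM s' h h1 h2 h3).elim
      · simp only [Finset.mem_product, Finset.mem_singleton] at h1 h2 h3
        rw [hu b' ⟨hb', h1.1, h2.1, h3.1⟩, h1.2]
      · exact (hL L' hL' (hSsub _ hL' _ h _ h1) (hSsub _ hL' _ h _ h2)
          (hSsub _ hL' _ h _ h3)).elim
  have mixed : ∀ i a b c, a ≠ b →
      ∃! s, s ∈ M ∪ Pu ∪ Q ∧ (a, i) ∈ s ∧ (b, i) ∈ s ∧ (c, !i) ∈ s := by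
    intro i a b c hab
    obtain ⟨L, hL, ha, hb⟩ := hpair a b hab
    have nP : ∀ s ∈ Pu, (a, i) ∈ s → (b, i) ∈ s → (c, !i) ∈ s → False := by
      rintro s ⟨b, -, j, rfl⟩ h1 h2 h3
      simp only [Finset.mem_product, Finset.mem_singleton] at h1 h2 h3
      cases i <;> simp_all
    have hM : ∀ s ∈ M, (a, i) ∈ s → (b, i) ∈ s → (c, !i) ∈ s →
        ∃ d, c ≠ d ∧ f c d = f a b ∧ (∀ L ∈ A1, a ∈ L → b ∈ L → c ∈ L → d ∉ L) ∧
          s = {(a, i), (b, i), (c, !i), (d, !i)} := by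
      rintro s ⟨p, q, r, t, j, hpq, hrt, hff, hno, rfl⟩ h1 h2 h3
      exact mixed_rep f hf A1 hpq hrt hff hno hab h1 h2 h3
    by_cases hc : c ∈ L
    · obtain ⟨s, hs, hu⟩ := (hS L hL).2 (a, i) (by simpa) (b, i) (by simpa) (c, !i) (by simpa)
        (by simpa) (by simp) (by simp)
      refine ⟨s, ⟨Or.inr ⟨L, hL, hs.1⟩, hs.2⟩, ?_⟩
      rintro s' ⟨(h | h) | ⟨L', hL', h⟩, h1, h2, h3⟩
      · obtain ⟨d, hcd, hff, hno, -⟩ := hM s' h h1 h2 h3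
        exact (hno L hL ha hb hc (H2 L hL a ha b hb c hc d hab hcd hff.symm)).elim
      · exact (nP s' h h1 h2 h3).elim
      · have : L' = L := hpair' a b hab L' hL' L hL (hSsub _ hL' _ h _ h1)
          (hSsub _ hL' _ h _ h2) ha hb
        subst this
        exact hu s' ⟨h, h1, h2, h3⟩
    · obtain ⟨d, ⟨hcd, hff⟩, hu⟩ := H1 L hL a ha b hb hab c hc
      refine ⟨{(a, i), (b, i), (c, !i), (d, !i)}, ⟨Or.inl (Or.inl
        ⟨a, b, c, d, i, hab, hcd, hff.symm, ?_, rfl⟩), by simp⟩, ?_⟩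
      · intro L' hL' ha' hb' hc'
        exact (hc (hpair' a b hab L' hL' L hL ha' hb' ha hb ▸ hc')).elim
      · rintro s' ⟨(h | h) | ⟨L', hL', h⟩, h1, h2, h3⟩
        · obtain ⟨d', hcd', hff', hno, rfl⟩ := hM s' h h1 h2 h3
          rw [hu d' ⟨hcd', hff'⟩]
        · exact (nP s' h h1 h2 h3).elim
        · have : L' = L := hpair' a b hab L' hL' L hL (hSsub _ hL' _ h _ h1)
            (hSsub _ hL' _ h _ h2) ha hb
          subst this
          exact (hc (hSsub _ hL' _ h _ h3)).elim
  refine ⟨M ∪ Pu ∪ Q, ?_, ?_⟩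
  · intro s hs
    refine ⟨?_, Finset.subset_univ _⟩
    rcases hs with (⟨a, b, c, d, i, hab, hcd, -, -, rfl⟩ | ⟨b, hb, i, rfl⟩) | ⟨L, hL, h⟩
    · left
      rw [Finset.card_insert_of_notMem, Finset.card_insert_of_notMem,
        Finset.card_insert_of_notMem, Finset.card_singleton] <;> simp [*]
    · simpa using hcard b hb
    · exact ((hS L hL).1 s h).1
  · rintro ⟨x, i⟩ - ⟨y, j⟩ - ⟨z, k⟩ - hxy hxz hyz
    by_cases hij : i = j
    · subst hij
      have hxy' : x ≠ y := fun h => hxy (by rw [h])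
      by_cases hik : i = k
      · subst hik
        exact pure i x y z hxy' (fun h => hxz (by rw [h])) (fun h => hyz (by rw [h]))
      · have : k = !i := bool_flip hik
        subst this
        exact mixed i x y z hxy'
    · have : j = !i := bool_flip hij
      subst this
      by_cases hik : i = k
      · subst hik
        have hh := mixed i x z y (fun h => hxz (by rw [h]))
        convert hh using 3
        tauto
      · have : k = !i := bool_flip hik
        subst this
        have hh := mixed (!i) y z x (fun h => hyz (by rw [h]))
        rw [Bool.not_not] at hh
        convert hh using 3
        tauto

/-- A 1-FG of type `1^n` with set-families of blocks. -/
structure Fan {V : Type*} (A1 AT : Set (Finset V)) : Prop where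
  c1 : ∀ L ∈ A1, L.card = 3 ∨ L.card = 5
  cT : ∀ b ∈ AT, b.card = 4 ∨ b.card = 6
  pair : ∀ x y, x ≠ y → ∃! L, L ∈ A1 ∧ x ∈ L ∧ y ∈ L
  tr : ∀ x y z, x ≠ y → x ≠ z → y ≠ z → (∀ L ∈ A1, x ∈ L → y ∈ L → z ∉ L) →
      ∃! b, b ∈ AT ∧ x ∈ b ∧ y ∈ b ∧ z ∈ b
  tr' : ∀ x y z, x ≠ y → x ≠ z → y ≠ z → ∀ L ∈ A1, x ∈ L → y ∈ L → z ∈ L →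
      ∀ b ∈ AT, x ∈ b → y ∈ b → z ∉ b

lemma exists_fan {m : ℕ} (h : HasS (m + 1)) :
    ∃ A1 AT : Set (Finset (Fin m)), Fan A1 AT := by
  obtain ⟨B, hB, hB3⟩ := h.on (Option (Fin m)) (by simp)
  have cases_fin : ∀ s : Finset (Option (Fin m)),
      (∃ t, s = Finset.insertNone t) ∨ (∃ t : Finset (Fin m), s = t.map Function.Embedding.some) := by
    intro s
    by_cases hs : none ∈ s
    · left
      refine ⟨Finset.eraseNone s, ?_⟩
      ext x; cases x <;> simp [hs]
    · right
      refine ⟨Finset.eraseNone s, ?_⟩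
      ext x; cases x <;> simp [hs]
  refine ⟨{L | Finset.insertNone L ∈ B}, {b | b.map Function.Embedding.some ∈ B},
    ?_, ?_, ?_, ?_, ?_⟩
  · intro L hL
    have := (hB _ hL).1
    rw [Finset.card_insertNone] at this
    omega
  · intro b hb
    have := (hB _ hb).1
    rwa [Finset.card_map] at this
  · intro x y hxy
    obtain ⟨s, hs, hu⟩ := hB3 none (mem_univ _) (some x) (mem_univ _) (some y) (mem_univ _)
      (by simp) (by simp) (by simpa)
    rcases cases_fin s with ⟨t, rfl⟩ | ⟨t, rfl⟩
    · refine ⟨t, ⟨hs.1, by simpa using hs.2⟩, ?_⟩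
      rintro t' ⟨h1, h2, h3⟩
      exact Finset.insertNone.injective (hu _ ⟨h1, by simp, by simpa, by simpa⟩)
    · simp at hs
  · intro x y z hxy hxz hyz hno
    obtain ⟨s, hs, hu⟩ := hB3 (some x) (mem_univ _) (some y) (mem_univ _) (some z) (mem_univ _)
      (by simpa) (by simpa) (by simpa)
    rcases cases_fin s with ⟨t, rfl⟩ | ⟨t, rfl⟩
    · have h2 := hs.2
      simp only [Finset.some_mem_insertNone] at h2
      exact (hno t hs.1 h2.1 h2.2.1 h2.2.2).elim
    · refine ⟨t, ⟨hs.1, by simpa using hs.2⟩, ?_⟩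
      rintro t' ⟨h1, h2, h3, h4⟩
      exact Finset.map_injective _ (hu _ ⟨h1, by simpa, by simpa, by simpa⟩)
  · intro x y z hxy hxz hyz L hL hx hy hz b hb hx' hy' hz'
    obtain ⟨s, hs, hu⟩ := hB3 (some x) (mem_univ _) (some y) (mem_univ _) (some z) (mem_univ _)
      (by simpa) (by simpa) (by simpa)
    have e1 := hu (Finset.insertNone L) ⟨hL, by simpa, by simpa, by simpa⟩
    have e2 := hu (b.map Function.Embedding.some) ⟨hb, by simpa, by simpa, by simpa⟩
    have : none ∈ b.map Function.Embedding.some := by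
      rw [e2, ← e1]; simp
    simp at this

/-- An idempotent commutative quasigroup on a 3-set or 5-set. -/
lemma exists_op {V : Type*} [DecidableEq V] (L : Finset V) (hL : L.card = 3 ∨ L.card = 5) :
    ∃ op : V → V → V, (∀ a ∈ L, ∀ b ∈ L, op a b ∈ L) ∧ (∀ a ∈ L, op a a = a) ∧
      (∀ a ∈ L, ∀ b ∈ L, op a b = op b a) ∧
      (∀ a ∈ L, ∀ x ∈ L, ∃ b ∈ L, op a b = x) ∧
      (∀ a ∈ L, ∀ b ∈ L, ∀ c ∈ L, op a b = op a c → b = c) := by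
  have key : ∃ q : Fin L.card → Fin L.card → Fin L.card, (∀ a, q a a = a) ∧
      (∀ a b, q a b = q b a) ∧ (∀ a x, ∃ b, q a b = x) ∧
      (∀ a b c, q a b = q a c → b = c) := by
    rcases hL with h | h
    · rw [h]
      exact ⟨fun a b => 2 * (a + b), by decide, by decide, by decide, by decide⟩
    · rw [h]
      exact ⟨fun a b => 3 * (a + b), by decide, by decide, by decide, by decide⟩
  obtain ⟨q, q1, q2, q3, q4⟩ := key
  let e := L.equivFin
  let op : V → V → V := fun a b =>
    if h : a ∈ L ∧ b ∈ L then (e.symm (q (e ⟨a, h.1⟩) (e ⟨b, h.2⟩))).1 else a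
  have hop : ∀ a (ha : a ∈ L) b (hb : b ∈ L), op a b =
      (e.symm (q (e ⟨a, ha⟩) (e ⟨b, hb⟩))).1 := by
    intro a ha b hb
    simp only [op, ha, hb, and_self, dite_true]
  refine ⟨op, ?_, ?_, ?_, ?_, ?_⟩
  · intro a ha b hb
    rw [hop a ha b hb]
    exact (e.symm _).2
  · intro a ha
    rw [hop a ha a ha, q1]; simp
  · intro a ha b hb
    rw [hop a ha b hb, hop b hb a ha, q2]
  · intro a ha x hx
    obtain ⟨b, hb⟩ := q3 (e ⟨a, ha⟩) (e ⟨x, hx⟩)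
    refine ⟨(e.symm b).1, (e.symm b).2, ?_⟩
    rw [hop a ha _ (e.symm b).2]
    simp [hb]
  · intro a ha b hb c hc h
    rw [hop a ha b hb, hop a ha c hc] at h
    have h1 := q4 _ _ _ (e.symm.injective (Subtype.ext h))
    have h2 := e.injective h1
    simpa using h2

lemma local_sys {V : Type*} (L : Finset V) (hL : L.card = 2 ∨ L.card = 3 ∨ L.card = 5) :
    ∃ B, SysOn (L ×ˢ (Finset.univ : Finset Bool)) B := by
  rcases hL with h | h | h
  · exact (hasS_single 4 (Or.inl rfl)).onFinset _ (by simp [h])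
  · exact (hasS_single 6 (Or.inr rfl)).onFinset _ (by simp [h])
  · exact hasS_ten.onFinset _ (by simp [h])

/-- `v → 2v - 2`. -/
lemma step_two_sub {m : ℕ} (h : HasS (m + 1)) : HasS (2 * m) := by
  classical
  obtain ⟨A1, AT, hF⟩ := exists_fan h
  have hS : ∀ L : Finset (Fin m), ∃ B, L ∈ A1 → SysOn (L ×ˢ (Finset.univ : Finset Bool)) B := by
    intro L
    by_cases hL : L ∈ A1
    · obtain ⟨B, hB⟩ := local_sys L (Or.inr (hF.c1 L hL))
      exact ⟨B, fun _ => hB⟩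
    · exact ⟨∅, fun h => (hL h).elim⟩
  choose S hS using hS
  choose op op1 op2 op3 op4 op5 using fun (L : Finset (Fin m)) (hL : L ∈ A1) =>
    exists_op L (hF.c1 L hL)
  choose! line hline hline' using hF.pair
  simp only at hline hline'
  have uniq : ∀ x y, x ≠ y → ∀ L ∈ A1, ∀ L' ∈ A1, x ∈ L → y ∈ L → x ∈ L' → y ∈ L' → L = L' := by
    intro x y hxy L hL L' hL' h1 h2 h3 h4
    rw [hline' x y hxy L ⟨hL, h1, h2⟩, hline' x y hxy L' ⟨hL', h3, h4⟩]
  let f : Fin m → Fin m → Fin m := fun a b =>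
    if hab : a = b then a else op (line a b) (hline a b hab).1 a b
  have hfid : ∀ a, f a a = a := fun a => by simp [f]
  have hfL : ∀ L (hL : L ∈ A1), ∀ a ∈ L, ∀ b ∈ L, f a b = op L hL a b := by
    intro L hL a ha b hb
    by_cases hab : a = b
    · subst hab
      rw [hfid, op2 L hL a ha]
    · have : line a b = L := (hline' a b hab L ⟨hL, ha, hb⟩).symm
      subst this
      simp [f, hab]
  have hfmem : ∀ L ∈ A1, ∀ a ∈ L, ∀ b ∈ L, f a b ∈ L := by
    intro L hL a ha b hb
    rw [hfL L hL a ha b hb]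
    exact op1 L hL a ha b hb
  have hcomm : ∀ a b, f a b = f b a := by
    intro a b
    by_cases hab : a = b
    · rw [hab]
    · obtain ⟨hL, ha, hb⟩ := hline a b hab
      rw [hfL _ hL a ha b hb, hfL _ hL b hb a ha, op3 _ hL a ha b hb]
  have hsolve : ∀ L ∈ A1, ∀ a ∈ L, ∀ x ∈ L, ∃ b ∈ L, f a b = x := by
    intro L hL a ha x hx
    obtain ⟨b, hb, h⟩ := op4 L hL a ha x hx
    exact ⟨b, hb, by rw [hfL L hL a ha b hb, h]⟩
  have hne : ∀ a b, a ≠ b → f a b ≠ a := by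
    intro a b hab h
    obtain ⟨hL, ha, hb⟩ := hline a b hab
    rw [hfL _ hL a ha b hb] at h
    exact hab (op5 _ hL a ha a ha b hb (by rw [h, op2 _ hL a ha]))
  have hcancel : ∀ a b c, f a b = f a c → b = c := by
    intro a b c h
    by_cases hab : a = b
    · subst hab
      by_contra hac
      exact hne a c hac (by rw [← h, hfid])
    by_cases hac : a = c
    · subst hac
      exact (hne a b hab (by rw [h, hfid])).elim
    obtain ⟨hL, ha, hb⟩ := hline a b hab
    obtain ⟨hM, ha', hc⟩ := hline a c hac
    have hx := hfmem _ hL a ha b hb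
    have hx' := hfmem _ hM a ha' c hc
    rw [← h] at hx'
    have e : line a b = line a c := uniq a (f a b) (hne a b hab).symm _ hL _ hM ha hx ha' hx'
    rw [← e] at hc
    apply op5 _ hL a ha b hb c hc
    rw [← hfL _ hL a ha b hb, ← hfL _ hL a ha c hc, h]
  obtain ⟨B, hB⟩ := double_step A1 AT S f
    (fun x y hxy => ⟨line x y, hline x y hxy⟩) uniq hF.cT hF.tr hF.tr' hS hcomm
    (by
      intro L hL a ha b hb hab c hc
      have hx := hfmem L hL a ha b hb
      have hcx : c ≠ f a b := fun h => hc (h ▸ hx)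
      obtain ⟨hM, hc', hx'⟩ := hline c (f a b) hcx
      obtain ⟨d, hd, hfd⟩ := hsolve _ hM c hc' _ hx'
      refine ⟨d, ⟨?_, hfd⟩, ?_⟩
      · rintro rfl
        rw [hfid] at hfd
        exact hcx hfd
      · rintro d' ⟨-, hd'⟩
        exact hcancel c _ _ (hd'.trans hfd.symm))
    (by
      intro L hL a ha b hb c hc d hab hcd hff
      obtain ⟨d', hd', h'⟩ := hsolve L hL c hc (f a b) (hfmem L hL a ha b hb)
      rw [hcancel c d d' (hff.symm.trans h'.symm)]
      exact hd')
  exact HasS.of_sys hB (by simp [mul_comm])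

/-- A one-factorization of the complete graph on `Option (ZMod m)`, `m` odd. -/
def oneFac {m : ℕ} : Option (ZMod m) → Option (ZMod m) → ZMod m
  | some a, some b => a + b
  | some a, none => a + a
  | none, some a => a + a
  | none, none => 0

lemma oneFac_spec {m : ℕ} (hm : m % 2 = 1) (c : Option (ZMod m)) (x : ZMod m) :
    ∃! d, c ≠ d ∧ oneFac c d = x := by
  obtain ⟨k, hk⟩ : ∃ k, m = 2 * k + 1 := ⟨m / 2, by omega⟩
  have h0 : (2 * (k : ZMod m) + 1) = 0 := by
    have := ZMod.natCast_self m
    rw [hk] at this ⊢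
    push_cast at this
    exact this
  have hhalf : ∀ y : ZMod m, (-(k : ZMod m) * y) + (-(k : ZMod m) * y) = y := by
    intro y
    linear_combination (-y) * h0
  have hinj : ∀ y z : ZMod m, y + y = z + z → y = z := by
    intro y z h
    linear_combination (-(k : ZMod m)) * h + (y - z) * h0
  cases c with
  | none =>
    refine ⟨some (-(k : ZMod m) * x), ⟨by simp, hhalf x⟩, ?_⟩
    rintro (_ | d) ⟨h1, h2⟩
    · exact (h1 rfl).elim
    · rw [hinj d _ (h2.trans (hhalf x).symm)]
  | some a =>
    by_cases hx : x = a + a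
    · refine ⟨none, ⟨by simp, hx.symm⟩, ?_⟩
      rintro (_ | d) ⟨h1, h2⟩
      · rfl
      · have h2' : a + d = x := h2
        rw [hx] at h2'
        exact (h1 (by rw [add_left_cancel h2'])).elim
    · refine ⟨some (x - a), ⟨?_, ?_⟩, ?_⟩
      · intro h
        apply hx
        have := Option.some.inj h
        linear_combination -this
      · change a + (x - a) = x
        ring
      · rintro (_ | d) ⟨h1, h2⟩
        · exact (hx h2.symm).elim
        · have h2' : a + d = x := h2
          rw [← h2']; simp

/-- `v → 2v`. -/
lemma step_two {m : ℕ} (hm : m % 2 = 1) (h : HasS (m + 1)) : HasS (2 * (m + 1)) := by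
  classical
  haveI : NeZero m := ⟨by omega⟩
  obtain ⟨AT, hAT, hAT3⟩ := h.on (Option (ZMod m)) (by simp)
  have hS : ∀ L : Finset (Option (ZMod m)), ∃ B, L.card = 2 →
      SysOn (L ×ˢ (Finset.univ : Finset Bool)) B := by
    intro L
    by_cases hL : L.card = 2
    · obtain ⟨B, hB⟩ := local_sys L (Or.inl hL)
      exact ⟨B, fun _ => hB⟩
    · exact ⟨∅, fun h => (hL h).elim⟩
  choose S hS using hS
  have hpr : ∀ x y, x ≠ y → ∀ L : Finset (Option (ZMod m)), L.card = 2 → x ∈ L → y ∈ L →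
      L = {x, y} := by
    intro x y hxy L hL hx hy
    symm
    apply Finset.eq_of_subset_of_card_le
    · intro w hw
      simp only [Finset.mem_insert, Finset.mem_singleton] at hw
      rcases hw with rfl | rfl <;> assumption
    · rw [hL, Finset.card_pair hxy]
  have hcomm : ∀ a b : Option (ZMod m), oneFac a b = oneFac b a := by
    rintro (_ | a) (_ | b)
    · rfl
    · rfl
    · rfl
    · exact add_comm a b
  obtain ⟨B, hB⟩ := double_step {L : Finset (Option (ZMod m)) | L.card = 2} AT S oneFac
    (fun x y hxy => ⟨{x, y}, Finset.card_pair hxy, by simp, by simp⟩)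
    (by
      intro x y hxy L hL L' hL' h1 h2 h3 h4
      rw [hpr x y hxy L hL h1 h2, hpr x y hxy L' hL' h3 h4])
    (fun b hb => (hAT b hb).1)
    (fun x y z hxy hxz hyz _ => hAT3 x (mem_univ _) y (mem_univ _) z (mem_univ _) hxy hxz hyz)
    (by
      intro x y z hxy hxz hyz L hL hx hy hz
      rw [hpr x y hxy L hL hx hy] at hz
      simp only [Finset.mem_insert, Finset.mem_singleton] at hz
      rcases hz with rfl | rfl
      · exact (hxz rfl).elim
      · exact (hyz rfl).elim)
    hS hcomm
    (fun L hL a ha b hb hab c hc => oneFac_spec hm c _)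
    (by
      intro L hL a ha b hb c hc d hab hcd hff
      have hc' := hc
      rw [hpr a b hab L hL ha hb] at hc'
      simp only [Finset.mem_insert, Finset.mem_singleton] at hc'
      rcases hc' with rfl | rfl
      · rw [(oneFac_spec hm c (oneFac c b)).unique ⟨hcd, hff.symm⟩ ⟨hab, rfl⟩]
        exact hb
      · rw [hcomm a c] at hff
        rw [(oneFac_spec hm c (oneFac c a)).unique ⟨hcd, hff.symm⟩ ⟨hab.symm, rfl⟩]
        exact ha)
  exact HasS.of_sys hB (by simp [mul_comm])

lemma hasS_all (m : ℕ) (hm : m % 2 = 1) : HasS (m + 1) := by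
  induction m using Nat.strong_induction_on with
  | _ m ih =>
    by_cases h1 : m = 1
    · subst h1
      exact hasS_two
    by_cases h3 : m % 4 = 3
    · have := step_two (m := (m - 1) / 2) (by omega) (ih _ (by omega) (by omega))
      rwa [show 2 * ((m - 1) / 2 + 1) = m + 1 by omega] at this
    · have := step_two_sub (m := (m + 1) / 2) (ih _ (by omega) (by omega))
      rwa [show 2 * ((m + 1) / 2) = m + 1 by omega] at this

lemma lamF_eq_one {V : Type*} [DecidableEq V] (A : Finset (Finset V)) (T : Finset V)
    (h : ∃! b, b ∈ A ∧ T ⊆ b) : lamF A.val T = 1 := by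
  obtain ⟨b, hb, hu⟩ := h
  have : A.filter (fun B => T ⊆ B) = {b} := by
    ext x
    simp only [Finset.mem_filter, Finset.mem_singleton]
    exact ⟨fun h => hu x h, fun h => h ▸ hb⟩
  have h2 := congrArg Finset.card this
  rw [Finset.card_singleton] at h2
  exact h2

lemma lamF_eq_zero {V : Type*} [DecidableEq V] (A : Finset (Finset V)) (T : Finset V)
    (h : ∀ b ∈ A, ¬ T ⊆ b) : lamF A.val T = 0 := by
  have : A.filter (fun B => T ⊆ B) = ∅ := by
    ext x
    simp only [Finset.mem_filter, Finset.notMem_empty, iff_false, not_and]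
    exact h x
  have h2 := congrArg Finset.card this
  rw [Finset.card_empty] at h2
  exact h2

lemma lamF_add {V : Type*} [DecidableEq V] (A B : Multiset (Finset V)) (T : Finset V) :
    lamF (A + B) T = lamF A T + lamF B T := by
  simp [lamF, Multiset.filter_add]

/-- existence of 1-FG(3,({3,5},{4,6}),n) of type 1^n for odd n. -/
theorem stmt_9 (n : ℕ) (hn : 0 < n) (hodd : n % 2 = 1) :
    ∃ A1 AT : Multiset (Finset (Fin n)),
      Is1FG n ({3, 5} : Set ℕ) ({4, 6} : Set ℕ) A1 AT := by
  classical
  obtain ⟨A1, AT, hF⟩ := exists_fan (hasS_all n hodd)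
  refine ⟨A1.toFinset.val, AT.toFinset.val, ?_, ?_, ?_, ?_⟩
  · intro B hB
    have := hF.c1 B (by simpa using hB)
    simpa using this
  · intro B hB
    have := hF.cT B (by simpa using hB)
    simpa using this
  · intro p hp
    obtain ⟨x, y, hxy, rfl⟩ := Finset.card_eq_two.1 (Finset.mem_powersetCard.1 hp).2
    apply lamF_eq_one
    simpa [Finset.insert_subset_iff] using hF.pair x y hxy
  · intro T hT
    obtain ⟨x, y, z, hxy, hxz, hyz, rfl⟩ :=
      Finset.card_eq_three.1 (Finset.mem_powersetCard.1 hT).2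
    rw [lamF_add]
    by_cases hL : ∃ L ∈ A1, x ∈ L ∧ y ∈ L ∧ z ∈ L
    · obtain ⟨L, hL, hx, hy, hz⟩ := hL
      rw [lamF_eq_one, lamF_eq_zero]
      · intro b hb hsub
        simp only [Finset.insert_subset_iff, Finset.singleton_subset_iff] at hsub
        exact hF.tr' x y z hxy hxz hyz L hL hx hy hz b (by simpa using hb)
          hsub.1 hsub.2.1 hsub.2.2
      · refine ⟨L, ⟨by simpa using hL, by simp [Finset.insert_subset_iff, *]⟩, ?_⟩
        rintro L' ⟨hL', hsub⟩
        simp only [Finset.insert_subset_iff, Finset.singleton_subset_iff] at hsub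
        exact (hF.pair x y hxy).unique ⟨by simpa using hL', hsub.1, hsub.2.1⟩ ⟨hL, hx, hy⟩
    · push Not at hL
      rw [lamF_eq_zero, lamF_eq_one]
      · simpa [Finset.insert_subset_iff] using hF.tr x y z hxy hxz hyz hL
      · intro b hb hsub
        simp only [Finset.insert_subset_iff, Finset.singleton_subset_iff] at hsub
        exact hL b (by simpa using hb) hsub.1 hsub.2.1 hsub.2.2

end DataPlacement
end
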